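/- arXiv:1811.12794 — 2 statements merged into one kernel-verified Lean document; each statement's English description precedes it below -/
import Mathlib

section
/- For natural numbers k and j, the Legendre polynomials satisfy the orthogonality relation ∫_{−1}^{1} P_k(x) P_j(x) · (1/2) dx = δ_{kj}/(2k+1), i.e., the integral vanishes when j ≠ k and equals 1/(2k+1) when j = k. -/
open Real Polynomial

/-- The `k`-th Legendre polynomial, defined by Rodrigues' formula
`P_k(x) = 1/(2^k k!) dᵏ/dxᵏ (x²-1)^k`. -/
noncomputable def legendre (k : ℕ) : Polynomial ℝ :=
  ((1 : ℝ) / (2 ^ k * k.factorial)) • (derivative^[k] ((X ^ 2 - 1) ^ k))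

lemma leg_int (p : Polynomial ℝ) : IntervalIntegrable (fun x => p.eval x) MeasureTheory.volume (-1) 1 :=
  p.continuous.intervalIntegrable _ _

lemma leg_ftc (p : Polynomial ℝ) :
    ∫ x in (-1 : ℝ)..1, (derivative p).eval x = p.eval 1 - p.eval (-1) :=
  intervalIntegral.integral_eq_sub_of_hasDerivAt (fun x _ => p.hasDerivAt x) (leg_int _)

lemma leg_bdry (k i : ℕ) (hi : i < k) (a : ℝ) (ha : a ^ 2 = 1) :
    (derivative^[i] ((X ^ 2 - 1 : Polynomial ℝ) ^ k)).eval a = 0 := by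
  have h1 : (X - C a) ^ k ∣ (X ^ 2 - 1 : Polynomial ℝ) ^ k := by
    apply pow_dvd_pow_of_dvd
    rw [dvd_iff_isRoot]
    simp [ha]
  have h2 := pow_sub_dvd_iterate_derivative_of_pow_dvd i h1
  have h3 : (X - C a) ∣ derivative^[i] ((X ^ 2 - 1 : Polynomial ℝ) ^ k) :=
    (dvd_pow_self _ (by omega)).trans h2
  exact dvd_iff_isRoot.mp h3

lemma leg_parts (k i : ℕ) (hi : i ≤ k) (p : Polynomial ℝ) :
    ∫ x in (-1 : ℝ)..1, p.eval x * (derivative^[i] ((X ^ 2 - 1 : Polynomial ℝ) ^ k)).eval x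
      = (-1) ^ i * ∫ x in (-1 : ℝ)..1,
        (derivative^[i] p).eval x * ((X ^ 2 - 1 : Polynomial ℝ) ^ k).eval x := by
  induction i generalizing p with
  | zero => simp
  | succ i ih =>
    have h := leg_ftc (p * derivative^[i] ((X ^ 2 - 1 : Polynomial ℝ) ^ k))
    rw [eval_mul, eval_mul, leg_bdry k i (by omega) 1 (by norm_num),
      leg_bdry k i (by omega) (-1) (by norm_num), derivative_mul] at h
    simp only [eval_add] at h
    rw [intervalIntegral.integral_add (leg_int _) (leg_int _)] at h
    simp only [eval_mul] at h
    rw [ih (by omega)] at h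
    rw [Function.iterate_succ_apply', Function.iterate_succ_apply, pow_succ (-1 : ℝ)]
    linarith

lemma leg_W (k : ℕ) :
    ((2 * k + 1).factorial : ℝ) * ∫ x in (-1 : ℝ)..1, ((X ^ 2 - 1 : Polynomial ℝ) ^ k).eval x
      = (-1) ^ k * 2 * 4 ^ k * (k.factorial : ℝ) ^ 2 := by
  induction k with
  | zero => simp; norm_num
  | succ k ih =>
    have h := leg_ftc (X * (X ^ 2 - 1 : Polynomial ℝ) ^ (k + 1))
    have e : derivative (X * (X ^ 2 - 1 : Polynomial ℝ) ^ (k + 1))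
        = C (2 * (k : ℝ) + 3) * (X ^ 2 - 1 : Polynomial ℝ) ^ (k + 1)
          + C (2 * (k : ℝ) + 2) * (X ^ 2 - 1 : Polynomial ℝ) ^ k := by
      rw [derivative_mul, derivative_pow]
      have c2 : C (2 : ℝ) = 2 := map_ofNat C 2
      have c3 : C (3 : ℝ) = 3 := map_ofNat C 3
      simp [c2, c3]
      ring
    rw [e] at h
    simp only [eval_add] at h
    rw [intervalIntegral.integral_add (leg_int _) (leg_int _)] at h
    simp only [eval_mul, eval_C] at h
    rw [intervalIntegral.integral_const_mul, intervalIntegral.integral_const_mul] at h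
    have e0 : eval 1 X * eval 1 ((X ^ 2 - 1 : Polynomial ℝ) ^ (k + 1))
      - eval (-1) X * eval (-1) ((X ^ 2 - 1 : Polynomial ℝ) ^ (k + 1)) = 0 := by simp
    rw [e0] at h
    have f : ((2 * (k + 1) + 1).factorial : ℝ)
        = (2 * k + 3) * (2 * k + 2) * ((2 * k + 1).factorial : ℝ) := by
      rw [show 2 * (k + 1) + 1 = (2 * k + 1) + 1 + 1 by ring, Nat.factorial_succ (2 * k + 1 + 1),
        Nat.factorial_succ (2 * k + 1)]
      push_cast; ring
    rw [f, Nat.factorial_succ k]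
    push_cast
    linear_combination (2 * (k : ℝ) + 2) * ((2 * k + 1).factorial : ℝ) * h
      - (2 * (k : ℝ) + 2) ^ 2 * ih

lemma leg_monic (k : ℕ) : ((X ^ 2 - 1 : Polynomial ℝ) ^ k).Monic := by
  apply Monic.pow
  simpa using monic_X_pow_sub_C (1 : ℝ) (two_ne_zero)

lemma leg_deg (k : ℕ) : ((X ^ 2 - 1 : Polynomial ℝ) ^ k).natDegree = 2 * k := by
  have : (X ^ 2 - 1 : Polynomial ℝ).natDegree = 2 := by
    simpa using natDegree_X_pow_sub_C (n := 2) (r := (1 : ℝ))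
  rw [natDegree_pow, this, mul_comm]

lemma leg_top (k : ℕ) :
    derivative^[2 * k] ((X ^ 2 - 1 : Polynomial ℝ) ^ k) = C ((2 * k).factorial : ℝ) := by
  have hd : (derivative^[2 * k] ((X ^ 2 - 1 : Polynomial ℝ) ^ k)).natDegree ≤ 0 := by
    refine (natDegree_iterate_derivative _ _).trans ?_
    rw [leg_deg]; simp
  rw [eq_C_of_natDegree_le_zero hd, coeff_iterate_derivative]
  have := (leg_monic k).coeff_natDegree
  rw [leg_deg] at this
  simp [this, Nat.descFactorial_self]

lemma leg_lt (k j : ℕ) (h : j < k) :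
    ∫ x in (-1 : ℝ)..1, (legendre k).eval x * (legendre j).eval x * (1 / 2) = 0 := by
  have h1 := leg_parts k k le_rfl (legendre j)
  have h2 : derivative^[k] (legendre j) = 0 := by
    rw [legendre, iterate_derivative_smul, ← Function.iterate_add_apply,
      iterate_derivative_eq_zero (by rw [leg_deg]; omega), smul_zero]
  rw [h2] at h1
  simp only [eval_zero, zero_mul, intervalIntegral.integral_zero, mul_zero] at h1
  have : ∀ x : ℝ, (legendre k).eval x * (legendre j).eval x * (1 / 2)
      = ((1 : ℝ) / (2 ^ k * k.factorial) / 2) * ((legendre j).eval x *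
        (derivative^[k] ((X ^ 2 - 1 : Polynomial ℝ) ^ k)).eval x) := by
    intro x
    rw [legendre, eval_smul, smul_eq_mul]; ring
  simp only [this]
  rw [intervalIntegral.integral_const_mul, h1, mul_zero]

/-- **Orthogonality of the Legendre polynomials** with respect to the uniform
probability density `1/2` on `(-1, 1)`:
`∫_{-1}^{1} P_k P_j (1/2) dx = δ_{kj}/(2k+1)`. -/
theorem legendre_orthogonality (k j : ℕ) :
    ∫ x in (-1 : ℝ)..1, (legendre k).eval x * (legendre j).eval x * (1 / 2)
      = if k = j then 1 / (2 * (k : ℝ) + 1) else 0 := by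
  rcases lt_trichotomy j k with h | h | h
  · rw [if_neg (by omega), leg_lt k j h]
  · subst h
    rw [if_pos rfl]
    have h1 := leg_parts j j le_rfl (derivative^[j] ((X ^ 2 - 1 : Polynomial ℝ) ^ j))
    rw [← Function.iterate_add_apply, ← two_mul, leg_top] at h1
    simp only [eval_C] at h1
    rw [intervalIntegral.integral_const_mul] at h1
    have : ∀ x : ℝ, (legendre j).eval x * (legendre j).eval x * (1 / 2)
        = (((1 : ℝ) / (2 ^ j * j.factorial)) ^ 2 / 2) *
          ((derivative^[j] ((X ^ 2 - 1 : Polynomial ℝ) ^ j)).eval x *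
          (derivative^[j] ((X ^ 2 - 1 : Polynomial ℝ) ^ j)).eval x) := by
      intro x
      rw [legendre, eval_smul, smul_eq_mul]; ring
    simp only [this]
    rw [intervalIntegral.integral_const_mul, h1]
    have h2 := leg_W j
    rw [Nat.factorial_succ] at h2
    push_cast at h2
    have hf : (j.factorial : ℝ) ≠ 0 := by positivity
    have h4 : (4 : ℝ) ^ j = (2 ^ j) ^ 2 := by rw [← pow_mul, mul_comm, pow_mul]; norm_num
    have h5 : ((-1 : ℝ) ^ j) * (-1) ^ j = 1 := by rw [← mul_pow]; norm_num
    have hp : (2 : ℝ) ^ j ≠ 0 := by positivity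
    have hk : 2 * (j : ℝ) + 1 ≠ 0 := by positivity
    rw [h4] at h2
    generalize (∫ x in (-1 : ℝ)..1, ((X ^ 2 - 1 : Polynomial ℝ) ^ j).eval x) = I at *
    generalize (2 : ℝ) ^ j = a at *
    generalize (-1 : ℝ) ^ j = s at *
    rw [eq_div_iff hk, div_pow, one_pow, div_div, one_div, mul_assoc,
      inv_mul_eq_iff_eq_mul₀ (by positivity)]
    linear_combination s * h2 + 2 * a ^ 2 * (j.factorial : ℝ) ^ 2 * h5
  · rw [if_neg (by omega), ← leg_lt j k h]
    congr 1
    ext x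
    ring
end

section
/- Let M be a natural number, let ω_0, …, ω_M be the M+1 distinct roots of the Legendre polynomial P_{M+1} in (−1,1), and let β_ℓ = ∫_{−1}^{1} Π_{j ≠ ℓ} (x − ω_j)/(ω_ℓ − ω_j) dx be the Gauss-Legendre weights. Then the discrete Legendre transform composed with the inverse discrete Legendre transform is the identity on coefficient vectors: for all real numbers a_0, …, a_M and every k ≤ M, ((2k+1)/2) · Σ_{ℓ=0}^{M} β_ℓ ( Σ_{j=0}^{M} a_j P_j(ω_ℓ) ) P_k(ω_ℓ) = a_k. -/
open Real Polynomial

/-- Integration of a polynomial over `[-1,1]`. -/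
noncomputable def legI (p : Polynomial ℝ) : ℝ := ∫ x in (-1 : ℝ)..1, p.eval x

lemma legI_int (p : Polynomial ℝ) :
    IntervalIntegrable (fun x => p.eval x) MeasureTheory.volume (-1 : ℝ) 1 :=
  p.continuous.intervalIntegrable _ _

lemma legI_add (p q : Polynomial ℝ) : legI (p + q) = legI p + legI q := by
  simp only [legI, eval_add]
  exact intervalIntegral.integral_add (legI_int p) (legI_int q)

lemma legI_C_mul (c : ℝ) (q : Polynomial ℝ) : legI (C c * q) = c * legI q := by
  simp [legI]

lemma legI_sum {ι : Type*} (s : Finset ι) (f : ι → Polynomial ℝ) :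
    legI (∑ i ∈ s, f i) = ∑ i ∈ s, legI (f i) := by
  simp only [legI, eval_finsetSum]
  exact intervalIntegral.integral_finsetSum (fun i _ => legI_int (f i))

lemma legI_derivative (p : Polynomial ℝ) : legI (derivative p) = p.eval 1 - p.eval (-1) := by
  unfold legI
  exact intervalIntegral.integral_eq_sub_of_hasDerivAt (fun x _ => p.hasDerivAt x)
    (legI_int _)

lemma legI_parts (n m : ℕ) (hm : m ≤ n) : ∀ q : Polynomial ℝ,
    legI (derivative^[m] ((X ^ 2 - 1) ^ n) * q)
      = (-1) ^ m * legI ((X ^ 2 - 1) ^ n * derivative^[m] q) := by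
  induction m with
  | zero => intro q; simp
  | succ m ih =>
    intro q
    have h1 := legI_derivative (derivative^[m] ((X ^ 2 - 1) ^ n) * q)
    have hd : (X ^ 2 - 1 : Polynomial ℝ) ∣ derivative^[m] ((X ^ 2 - 1) ^ n) :=
      (dvd_pow_self _ (by omega)).trans (pow_sub_dvd_iterate_derivative_pow (X ^ 2 - 1) n m)
    obtain ⟨r, hr⟩ := hd
    have h2 : legI (derivative (derivative^[m] ((X ^ 2 - 1) ^ n) * q)) = 0 := by
      rw [h1, hr]; simp
    rw [derivative_mul, legI_add, ih (by omega) (derivative q)] at h2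
    rw [Function.iterate_succ_apply', Function.iterate_succ_apply, pow_succ (-1 : ℝ)]
    linarith

lemma legU_monic (n : ℕ) : ((X ^ 2 - 1 : Polynomial ℝ) ^ n).Monic := by
  apply Monic.pow
  have := monic_X_pow_sub_C (1 : ℝ) (n := 2) (by norm_num)
  simpa using this

lemma legU_natDegree (n : ℕ) : ((X ^ 2 - 1 : Polynomial ℝ) ^ n).natDegree = 2 * n := by
  rw [natDegree_pow]
  have : (X ^ 2 - 1 : Polynomial ℝ).natDegree = 2 := by
    have := natDegree_X_pow_sub_C (n := 2) (r := (1 : ℝ))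
    simpa using this
  rw [this]; ring

lemma legendre_natDegree (n : ℕ) : (legendre n).natDegree = n := by
  unfold legendre
  rw [natDegree_smul _ (by positivity)]
  apply le_antisymm
  · have := natDegree_iterate_derivative ((X ^ 2 - 1 : Polynomial ℝ) ^ n) n
    rw [legU_natDegree] at this
    omega
  · apply le_natDegree_of_ne_zero
    rw [coeff_iterate_derivative, ← two_mul, ← legU_natDegree n, (legU_monic n).coeff_natDegree,
      legU_natDegree]
    simp [Nat.descFactorial_eq_zero_iff_lt]
    omega

lemma legendre_ne (n : ℕ) (hn : n ≠ 0) : legendre n ≠ 0 := by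
  intro h
  have := legendre_natDegree n
  rw [h] at this
  simp at this
  omega

lemma legI_legendre_mul (n : ℕ) (q : Polynomial ℝ) : legI (legendre n * q)
    = 1 / (2 ^ n * n.factorial) * ((-1) ^ n * legI ((X ^ 2 - 1) ^ n * derivative^[n] q)) := by
  rw [← legI_parts n n le_rfl, ← legI_C_mul, legendre, smul_eq_C_mul, mul_assoc]

lemma legI_orth (n : ℕ) (q : Polynomial ℝ) (hq : q.natDegree < n) : legI (legendre n * q) = 0 := by
  rw [legI_legendre_mul, iterate_derivative_eq_zero hq]
  simp [legI]

lemma legJ (n : ℕ) : (-1) ^ n * legI ((X ^ 2 - 1) ^ n) * (2 * n + 1).factorial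
    = 2 * 4 ^ n * (n.factorial : ℝ) ^ 2 := by
  induction n with
  | zero => simp [legI]; norm_num
  | succ n ih =>
    have h1 := legI_derivative (X * (X ^ 2 - 1) ^ (n + 1))
    have h2 : derivative (X * (X ^ 2 - 1 : Polynomial ℝ) ^ (n + 1))
        = C (2 * n + 3 : ℝ) * (X ^ 2 - 1) ^ (n + 1) + C (2 * n + 2 : ℝ) * (X ^ 2 - 1) ^ n := by
      have h2' : (C 2 : Polynomial ℝ) = 2 := rfl
      have h3' : (C 3 : Polynomial ℝ) = 3 := rfl
      simp [derivative_mul, derivative_pow, h2', h3']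
      ring
    rw [h2, legI_add, legI_C_mul, legI_C_mul] at h1
    simp at h1
    have e : 2 * (n + 1) + 1 = (2 * n + 1) + 1 + 1 := by ring
    rw [e, Nat.factorial_succ, Nat.factorial_succ (2 * n + 1), Nat.factorial_succ n]
    push_cast
    have h3 : (2 * n + 3 : ℝ) * legI ((X ^ 2 - 1) ^ (n + 1))
        = -((2 * n + 2 : ℝ) * legI ((X ^ 2 - 1) ^ n)) := by linarith
    calc _ = (-1 : ℝ) ^ (n + 1) * ((2 * n + 3 : ℝ) * legI ((X ^ 2 - 1) ^ (n + 1)))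
            * (2 * n + 2) * (2 * n + 1).factorial := by ring
      _ = (2 * n + 2) ^ 2 * ((-1) ^ n * legI ((X ^ 2 - 1) ^ n) * (2 * n + 1).factorial) := by
          rw [h3]; ring
      _ = _ := by rw [ih]; ring

lemma legI_sq (n : ℕ) : legI (legendre n * legendre n) = 2 / (2 * n + 1) := by
  rw [legI_legendre_mul]
  have h : derivative^[n] (legendre n)
      = C (1 / (2 ^ n * n.factorial) * (2 * n).factorial : ℝ) := by
    rw [legendre, iterate_derivative_smul, ← Function.iterate_add_apply, ← two_mul,
      smul_eq_C_mul, C_mul]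
    congr 1
    have hd := natDegree_iterate_derivative ((X ^ 2 - 1 : Polynomial ℝ) ^ n) (2 * n)
    rw [legU_natDegree, Nat.sub_self] at hd
    rw [eq_C_of_natDegree_le_zero hd, coeff_iterate_derivative, zero_add, Nat.descFactorial_self]
    have := (legU_monic n).coeff_natDegree
    rw [legU_natDegree] at this
    rw [this]; simp
  rw [h, mul_comm _ (C _), legI_C_mul]
  have hJ := legJ n
  rw [Nat.factorial_succ] at hJ
  push_cast at hJ
  have h4 : (4 : ℝ) ^ n = 2 ^ n * 2 ^ n := by rw [← mul_pow]; norm_num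
  rw [h4] at hJ
  have : (n.factorial : ℝ) ≠ 0 := by positivity
  have : (2 * n + 1 : ℝ) ≠ 0 := by positivity
  field_simp
  linarith

lemma legI_pair (i j : ℕ) : legI (legendre i * legendre j)
    = if i = j then 2 / (2 * (j : ℝ) + 1) else 0 := by
  split_ifs with h
  · rw [h, legI_sq]
  · rcases lt_or_gt_of_ne h with h | h
    · rw [mul_comm]; exact legI_orth _ _ (by rwa [legendre_natDegree])
    · exact legI_orth _ _ (by rwa [legendre_natDegree])

lemma leg_gauss (M : ℕ)
    (ω : Fin (M + 1) → ℝ) (hω_inj : Function.Injective ω)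
    (hω_root : ∀ ℓ, (legendre (M + 1)).eval (ω ℓ) = 0)
    (β : Fin (M + 1) → ℝ)
    (hβ : ∀ ℓ, β ℓ
      = ∫ x in (-1 : ℝ)..1, ∏ j ∈ Finset.univ.erase ℓ, (x - ω j) / (ω ℓ - ω j))
    (p : Polynomial ℝ) (hp : p.natDegree < 2 * (M + 1)) :
    ∑ ℓ, β ℓ * p.eval (ω ℓ) = legI p := by
  set P := legendre (M + 1) with hP
  have hP0 : P ≠ 0 := legendre_ne _ (by omega)
  have hdiv : P * (p / P) + p % P = p := EuclideanDomain.div_add_mod p P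
  have hq : (p / P).natDegree < M + 1 := by
    by_cases h0 : p / P = 0
    · rw [h0]; simp
    have h1 : P.degree ≤ p.degree := by
      by_contra hlt
      exact h0 ((Polynomial.div_eq_zero_iff hP0).2 (not_le.1 hlt))
    have h2 := Polynomial.degree_add_div hP0 h1
    rw [← degree_mul] at h2
    have h3 := natDegree_eq_of_degree_eq h2
    rw [natDegree_mul hP0 h0, hP, legendre_natDegree, ← hP] at h3
    omega
  have hr : (p % P).degree < (Finset.univ : Finset (Fin (M + 1))).card := by
    have := EuclideanDomain.mod_lt p hP0
    have h2 : (p % P).degree < P.degree := this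
    rw [degree_eq_natDegree hP0, hP, legendre_natDegree] at h2
    simpa using h2
  have hI : legI p = legI (p % P) := by
    conv_lhs => rw [← hdiv]
    rw [legI_add, legI_orth _ _ hq, zero_add]
  have hev : ∀ ℓ, p.eval (ω ℓ) = (p % P).eval (ω ℓ) := by
    intro ℓ
    conv_lhs => rw [← hdiv]
    simp [hω_root]
  have hint := Lagrange.eq_interpolate (s := Finset.univ) (v := ω) hω_inj.injOn hr
  rw [hI, hint, Lagrange.interpolate_apply, legI_sum]
  apply Finset.sum_congr rfl
  intro ℓ _
  rw [legI_C_mul, hev, hβ, mul_comm]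
  congr 1
  unfold legI
  congr 1
  ext x
  simp only [Lagrange.basis, eval_prod, Lagrange.basisDivisor, eval_mul, eval_C, eval_sub, eval_X]
  exact Finset.prod_congr rfl fun j _ => by rw [div_eq_inv_mul]

/-- **DLT ∘ IDLT is the identity.**
Let `ω_0, …, ω_M` be the `M+1` distinct roots of `P_{M+1}` in `(-1,1)` and
`β_ℓ = ∫_{-1}^{1} Π_{j ≠ ℓ} (x - ω_j)/(ω_ℓ - ω_j) dx` the Gauss-Legendre
weights. Then for all coefficients `a_0, …, a_M` and every `k ≤ M`,
`((2k+1)/2) Σ_ℓ β_ℓ (Σ_j a_j P_j(ω_ℓ)) P_k(ω_ℓ) = a_k`. -/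
theorem dlt_idlt_identity (M : ℕ)
    (ω : Fin (M + 1) → ℝ) (hω_inj : Function.Injective ω)
    (hω_root : ∀ ℓ, (legendre (M + 1)).eval (ω ℓ) = 0)
    (hω_mem : ∀ ℓ, ω ℓ ∈ Set.Ioo (-1 : ℝ) 1)
    (β : Fin (M + 1) → ℝ)
    (hβ : ∀ ℓ, β ℓ
      = ∫ x in (-1 : ℝ)..1, ∏ j ∈ Finset.univ.erase ℓ, (x - ω j) / (ω ℓ - ω j))
    (a : Fin (M + 1) → ℝ) (k : Fin (M + 1)) :
    ((2 * (k : ℕ) + 1 : ℝ) / 2)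
        * ∑ ℓ, β ℓ * (∑ j, a j * (legendre (j : ℕ)).eval (ω ℓ))
            * (legendre (k : ℕ)).eval (ω ℓ)
      = a k := by
  have hg : ∀ j : Fin (M + 1), ∑ ℓ, β ℓ * (legendre (j : ℕ) * legendre (k : ℕ)).eval (ω ℓ)
      = if j = k then 2 / (2 * ((k : ℕ) : ℝ) + 1) else 0 := by
    intro j
    rw [leg_gauss M ω hω_inj hω_root β hβ, legI_pair]
    · simp only [Fin.ext_iff]
    · have h1 := natDegree_mul_le (p := legendre (j : ℕ)) (q := legendre (k : ℕ))
      rw [legendre_natDegree, legendre_natDegree] at h1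
      omega
  have hs : ∑ ℓ, β ℓ * (∑ j, a j * (legendre (j : ℕ)).eval (ω ℓ)) * (legendre (k : ℕ)).eval (ω ℓ)
      = ∑ j, a j * ∑ ℓ, β ℓ * (legendre (j : ℕ) * legendre (k : ℕ)).eval (ω ℓ) := by
    simp only [Finset.mul_sum, Finset.sum_mul]
    rw [Finset.sum_comm]
    refine Finset.sum_congr rfl fun j _ => Finset.sum_congr rfl fun ℓ _ => ?_
    rw [eval_mul]; ring
  rw [hs]
  simp only [hg]
  simp
  have : (2 * ((k : ℕ) : ℝ) + 1) ≠ 0 := by positivity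
  field_simp
end
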